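/- (Fractal equivalence principle for the Perron expansions.) Let P be a Perron system. Then for every set 𝔐 of sequences of positive integers, dim_H { Δ^P_c : c is a P-admissible infinite sequence with c ∈ 𝔐 } = dim_H { Δ^{P⁻}_c : c is a P-admissible infinite sequence with c ∈ 𝔐 }, where dim_H denotes the Hausdorff dimension. -/

import Mathlib

open Set Filter MeasureTheory
open scoped ENNReal

noncomputable section

/-- A Perron system `P = (φ_n)`: `φ₀ = φ []` and `φ_n(c₁,…,c_n) = φ [c₁,…,c_n]`;
all values are positive integers. -/
structure PerronSystem where
  φ : List ℕ → ℕ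
  φ_pos : ∀ l, 0 < φ l

/-- `(c₁−1)c₁⋯(c_n−1)c_n` (0-based indexing: `c 0 = c₁`). -/
def qprod (c : ℕ → ℕ) (n : ℕ) : ℝ :=
  ∏ i ∈ Finset.range n, (((c i : ℝ) - 1) * (c i : ℝ))

namespace PerronSystem

variable (P : PerronSystem)

/-- `r P c 0 = φ₀` and `r P c n = φ_n(c₁,…,c_n)`. -/
def r (c : ℕ → ℕ) (n : ℕ) : ℕ := P.φ (List.ofFn fun j : Fin n => c j)

/-- The word `c₁ … c_k` is P-admissible: `c_i ≥ φ_{i−1}(c₁,…,c_{i−1}) + 1`. -/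
def AdmissibleUpTo (c : ℕ → ℕ) (k : ℕ) : Prop := ∀ i < k, P.r c i + 1 ≤ c i

/-- The infinite digit sequence `c` is P-admissible. -/
def Admissible (c : ℕ → ℕ) : Prop := ∀ i, P.r c i + 1 ≤ c i

/-- `r₀ r₁ ⋯ r_{n−1}`. -/
def rprod (c : ℕ → ℕ) (n : ℕ) : ℝ := ∏ i ∈ Finset.range n, (P.r c i : ℝ)

/-- Diameter `D_k = r₀⋯r_{k−1} / ((c₁−1)c₁⋯(c_k−1)c_k)` of the cylinder with base `c₁…c_k`. -/
def D (c : ℕ → ℕ) (k : ℕ) : ℝ := P.rprod c k / qprod c k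

/-- `S_k`, the infimum of the positive Perron cylinder with base `c₁…c_k`. -/
def S (c : ℕ → ℕ) (k : ℕ) : ℝ :=
  ∑ n ∈ Finset.range k, P.rprod c (n + 1) / (qprod c n * (c n : ℝ))

/-- The positive Perron cylinder `Δ^P_{c₁…c_k} = (S_k, S_k + D_k]`. -/
def cyl (c : ℕ → ℕ) (k : ℕ) : Set ℝ := Ioc (P.S c k) (P.S c k + P.D c k)

/-- `A_k = ∑_{n=0}^{k−1} (−1)^n r₀⋯r_n / ((c₁−1)c₁⋯(c_n−1)c_n (c_{n+1}−1))`. -/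
def A (c : ℕ → ℕ) (k : ℕ) : ℝ :=
  ∑ n ∈ Finset.range k, (-1 : ℝ) ^ n * P.rprod c (n + 1) / (qprod c n * ((c n : ℝ) - 1))

/-- The second endpoint `A_k + (−1)^k D_k` of the interval `I_{c₁…c_k}`. -/
def altEnd (c : ℕ → ℕ) (k : ℕ) : ℝ := P.A c k + (-1 : ℝ) ^ k * P.D c k

/-- The countable set `IS^{P⁻}` of endpoints of the intervals `I_{c₁…c_k}`
(the word of length `0` contributes the endpoints `0` and `1`). -/
def IS : Set ℝ :=
  {x | ∃ (c : ℕ → ℕ) (k : ℕ), P.AdmissibleUpTo c k ∧ (x = P.A c k ∨ x = P.altEnd c k)}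

/-- The alternating Perron cylinder `Δ^{P⁻}_{c₁…c_k} = I_{c₁…c_k} \ IS^{P⁻}`. -/
def altCyl (c : ℕ → ℕ) (k : ℕ) : Set ℝ :=
  Ioo (min (P.A c k) (P.altEnd c k)) (max (P.A c k) (P.altEnd c k)) \ P.IS

/-- The family `𝔓` of all unions of consecutive positive Perron cylinders of the same
rank contained in a single cylinder of the previous rank. -/
def famP : Set (Set ℝ) :=
  {U | ∃ (c : ℕ → ℕ) (k n : ℕ), P.AdmissibleUpTo c k ∧ P.r c k + 1 ≤ n ∧
      ((∃ m, n ≤ m ∧ U = ⋃ i ∈ Finset.Icc n m, P.cyl (Function.update c k i) (k + 1)) ∨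
        U = ⋃ i ∈ {j : ℕ | n ≤ j}, P.cyl (Function.update c k i) (k + 1))}

/-- The subfamily `𝔓₁ ⊆ 𝔓` of finite unions. -/
def famP1 : Set (Set ℝ) :=
  {U | ∃ (c : ℕ → ℕ) (k n m : ℕ), P.AdmissibleUpTo c k ∧ P.r c k + 1 ≤ n ∧ n ≤ m ∧
      U = ⋃ i ∈ Finset.Icc n m, P.cyl (Function.update c k i) (k + 1)}

/-- The family `𝔓⁻` of all unions of consecutive alternating Perron cylinders of the same
rank contained in a single cylinder of the previous rank. -/
def famAlt : Set (Set ℝ) :=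
  {U | ∃ (c : ℕ → ℕ) (k n : ℕ), P.AdmissibleUpTo c k ∧ P.r c k + 1 ≤ n ∧
      ((∃ m, n ≤ m ∧ U = ⋃ i ∈ Finset.Icc n m, P.altCyl (Function.update c k i) (k + 1)) ∨
        U = ⋃ i ∈ {j : ℕ | n ≤ j}, P.altCyl (Function.update c k i) (k + 1))}

/-- The subfamily `𝔓₁⁻ ⊆ 𝔓⁻` of finite unions. -/
def famAlt1 : Set (Set ℝ) :=
  {U | ∃ (c : ℕ → ℕ) (k n m : ℕ), P.AdmissibleUpTo c k ∧ P.r c k + 1 ≤ n ∧ n ≤ m ∧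
      U = ⋃ i ∈ Finset.Icc n m, P.altCyl (Function.update c k i) (k + 1)}

/-- The value `Δ^P_c` of the positive Perron expansion with digit sequence `c`. -/
def posValue (c : ℕ → ℕ) : ℝ :=
  ∑' n : ℕ, P.rprod c (n + 1) / (qprod c n * (c n : ℝ))

/-- The value `Δ^{P⁻}_c` of the alternating Perron expansion with digit sequence `c`. -/
def altValue (c : ℕ → ℕ) : ℝ :=
  ∑' n : ℕ, (-1 : ℝ) ^ n * P.rprod c (n + 1) / (qprod c n * ((c n : ℝ) - 1))

end PerronSystem

/-- The Hausdorff `α`-dimensional measure of `E` with respect to a family of coverings `Φ`. -/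
def Hfam (Φ : Set (Set ℝ)) (α : ℝ) (E : Set ℝ) : ℝ≥0∞ :=
  ⨆ (ε : ℝ) (_ : 0 < ε),
    ⨅ (f : ℕ → Set ℝ) (_ : E ⊆ ⋃ n, f n) (_ : ∀ n, f n ∈ Φ)
      (_ : ∀ n, EMetric.diam (f n) ≤ ENNReal.ofReal ε),
      ∑' n : ℕ, EMetric.diam (f n) ^ α

/-- The Hausdorff dimension of `E` with respect to a family of coverings `Φ`:
`inf {α > 0 : H^α(E, Φ) = 0}` (equal to `∞` if no such `α` exists). -/
def dimFam (Φ : Set (Set ℝ)) (E : Set ℝ) : ℝ≥0∞ :=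
  ⨅ (α : ℝ) (_ : 0 < α) (_ : Hfam Φ α E = 0), ENNReal.ofReal α

end

theorem dimH_transfer {α : Type*} (f g : α → ℝ) (T0 : Set α)
    (K : ∀ T : Set α, T ⊆ T0 → ∀ δ : ℝ, 0 ≤ δ → (∀ x ∈ T, ∀ y ∈ T, |f x - f y| ≤ δ) →
      ∃ U : Fin 3 → Set α, T ⊆ ⋃ j, U j ∧ (∀ j, U j ⊆ T) ∧
        ∀ j, ∀ x ∈ U j, ∀ y ∈ U j, |g x - g y| ≤ 2 * δ) :
    dimH (g '' T0) ≤ dimH (f '' T0) := by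
  have K' : ∀ s : Set ℝ, ∃ U : Fin 3 → Set α, (T0 ∩ f ⁻¹' s) ⊆ ⋃ j, U j ∧
      ∀ j, Metric.ediam (g '' U j) ≤ 2 * Metric.ediam s := by
    intro s
    by_cases hs : Metric.ediam s = ⊤
    · refine ⟨fun _ => T0, ?_, ?_⟩
      · intro x hx
        exact mem_iUnion.2 ⟨0, hx.1⟩
      · intro j
        rw [hs]
        simp
    · obtain ⟨U, h1, h2, h3⟩ := K (T0 ∩ f ⁻¹' s) inter_subset_left (Metric.ediam s).toReal
        ENNReal.toReal_nonneg (by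
          intro x hx y hy
          have := Metric.edist_le_ediam_of_mem (x := f x) (y := f y) (s := s) hx.2 hy.2
          rw [edist_dist] at this
          have h := (ENNReal.ofReal_le_iff_le_toReal hs).1 this
          rwa [Real.dist_eq] at h)
      refine ⟨U, h1, fun j => ?_⟩
      apply Metric.ediam_le
      rintro _ ⟨x, hx, rfl⟩ _ ⟨y, hy, rfl⟩
      rw [edist_dist, Real.dist_eq]
      refine (ENNReal.ofReal_le_ofReal (h3 j x hx y hy)).trans ?_
      rw [ENNReal.ofReal_mul (by norm_num), ENNReal.ofReal_toReal hs]
      simp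
  choose U hU1 hU2 using K'
  refine le_of_forall_gt_imp_ge_of_dense fun a ha => ?_
  obtain ⟨d, hd1, hd2⟩ := ENNReal.lt_iff_exists_nnreal_btwn.1 ha
  refine le_trans ?_ hd2.le
  have hd0 : 0 < (d : ℝ) := by
    have : (0 : ℝ≥0∞) < d := lt_of_le_of_lt (zero_le) hd1
    exact_mod_cast this
  have hz := hausdorffMeasure_of_dimH_lt hd1
  apply dimH_le_of_hausdorffMeasure_ne_top
  have hcov : ∀ n : ℕ, ∃ t : ℕ → Set ℝ, f '' T0 ⊆ ⋃ i, t i ∧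
      (∀ i, Metric.ediam (t i) ≤ ((n : ℝ≥0∞) + 1)⁻¹) ∧
      ∑' i, Metric.ediam (t i) ^ (d : ℝ) ≤ 1 := by
    intro n
    rw [Measure.hausdorffMeasure_apply] at hz
    have h1 := ENNReal.iSup_eq_zero.1 (ENNReal.iSup_eq_zero.1 hz ((n : ℝ≥0∞) + 1)⁻¹) (by simp)
    have h2 : _ < (1 : ℝ≥0∞) := lt_of_eq_of_lt h1 one_pos
    simp only [iInf_lt_iff] at h2
    obtain ⟨t, ht1, ht2, ht3⟩ := h2
    refine ⟨t, ht1, ht2, le_trans (ENNReal.tsum_le_tsum fun i => ?_) ht3.le⟩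
    rcases (t i).eq_empty_or_nonempty with h | h
    · simp [h, hd0]
    · simp [h]
  choose t ht1 ht2 ht3 using hcov
  have hfin : ∀ n, ∑' i : ℕ × Fin 3, Metric.ediam (g '' U (t n i.1) i.2) ^ (d : ℝ)
      ≤ 3 * (2 : ℝ≥0∞) ^ (d : ℝ) := by
    intro n
    rw [ENNReal.tsum_prod']
    calc _ ≤ ∑' i : ℕ, (3 * (2 : ℝ≥0∞) ^ (d : ℝ)) * Metric.ediam (t n i) ^ (d : ℝ) := by
          refine ENNReal.tsum_le_tsum fun i => ?_
          rw [tsum_fintype]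
          calc _ ≤ ∑ j : Fin 3, (2 * Metric.ediam (t n i)) ^ (d : ℝ) :=
                Finset.sum_le_sum fun j _ => ENNReal.rpow_le_rpow (hU2 _ j) hd0.le
            _ = _ := by
                rw [ENNReal.mul_rpow_of_nonneg _ _ hd0.le]
                simp [mul_assoc]
      _ ≤ _ := by
          rw [ENNReal.tsum_mul_left]
          exact mul_le_of_le_one_right (zero_le) (ht3 n)
  have hr : Tendsto (fun n : ℕ => 2 * ((n : ℝ≥0∞) + 1)⁻¹) atTop (nhds 0) := by
    have h := ENNReal.tendsto_inv_nat_nhds_zero.comp (tendsto_add_atTop_nat 1)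
    have h2 := ENNReal.Tendsto.const_mul (a := 2) h (Or.inr (by simp))
    simpa using h2
  have hle := Measure.hausdorffMeasure_le_liminf_tsum (ι := fun _ : ℕ => ℕ × Fin 3) (d : ℝ) (g '' T0)
    (l := atTop) (fun n : ℕ => 2 * ((n : ℝ≥0∞) + 1)⁻¹) hr
    (fun n i => g '' U (t n i.1) i.2)
    (Eventually.of_forall fun n i => (hU2 _ _).trans (by gcongr; exact ht2 n i.1))
    (Eventually.of_forall fun n => by
      rintro _ ⟨x, hx, rfl⟩
      obtain ⟨i, hi⟩ := mem_iUnion.1 (ht1 n ⟨x, hx, rfl⟩)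
      obtain ⟨j, hj⟩ := mem_iUnion.1 (hU1 (t n i) ⟨hx, hi⟩)
      exact mem_iUnion.2 ⟨(i, j), x, hj, rfl⟩)
  have hlim : liminf (fun n => ∑' i : ℕ × Fin 3, Metric.ediam (g '' U (t n i.1) i.2) ^ (d : ℝ)) atTop
      ≤ 3 * (2 : ℝ≥0∞) ^ (d : ℝ) :=
    (liminf_le_liminf (Eventually.of_forall hfin)).trans (by simp)
  refine ne_top_of_le_ne_top ?_ (hle.trans hlim)
  exact ENNReal.mul_ne_top (by simp) (ENNReal.rpow_ne_top_of_nonneg hd0.le (by simp))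

namespace PerronSystem

variable (P : PerronSystem)

/-- Two digit sequences agree on the first `k` digits. -/
def Agree (c c' : ℕ → ℕ) (k : ℕ) : Prop := ∀ i < k, c i = c' i

theorem Agree.mono {c c' : ℕ → ℕ} {k j : ℕ} (h : Agree c c' k) (hj : j ≤ k) : Agree c c' j :=
  fun i hi => h i (hi.trans_le hj)

theorem Agree.succ {c c' : ℕ → ℕ} {k : ℕ} (h : Agree c c' k) (hj : c k = c' k) :
    Agree c c' (k + 1) := by
  intro i hi
  rcases Nat.lt_succ_iff_lt_or_eq.1 hi with h1 | rfl
  · exact h i h1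
  · exact hj

theorem r_congr {c c' : ℕ → ℕ} {k : ℕ} (h : Agree c c' k) : P.r c k = P.r c' k := by
  unfold r
  congr 2
  funext j
  exact h j j.2

theorem rprod_congr {c c' : ℕ → ℕ} {k : ℕ} (h : Agree c c' k) : P.rprod c k = P.rprod c' k := by
  unfold rprod
  refine Finset.prod_congr rfl fun i hi => ?_
  rw [P.r_congr (h.mono (Finset.mem_range.1 hi).le)]

theorem rprod_succ_congr {c c' : ℕ → ℕ} {k : ℕ} (h : Agree c c' k) :
    P.rprod c (k + 1) = P.rprod c' (k + 1) := by
  unfold rprod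
  refine Finset.prod_congr rfl fun i hi => ?_
  rw [P.r_congr (h.mono (Nat.lt_succ_iff.1 (Finset.mem_range.1 hi)))]

theorem qprod_congr {c c' : ℕ → ℕ} {k : ℕ} (h : Agree c c' k) : qprod c k = qprod c' k := by
  unfold qprod
  refine Finset.prod_congr rfl fun i hi => ?_
  rw [h i (Finset.mem_range.1 hi)]

theorem D_congr {c c' : ℕ → ℕ} {k : ℕ} (h : Agree c c' k) : P.D c k = P.D c' k := by
  unfold D
  rw [P.rprod_congr h, qprod_congr h]

theorem S_congr {c c' : ℕ → ℕ} {k : ℕ} (h : Agree c c' k) : P.S c k = P.S c' k := by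
  unfold S
  refine Finset.sum_congr rfl fun i hi => ?_
  have hi := Finset.mem_range.1 hi
  rw [P.rprod_succ_congr (h.mono hi.le), qprod_congr (h.mono hi.le), h i hi]

theorem A_congr {c c' : ℕ → ℕ} {k : ℕ} (h : Agree c c' k) : P.A c k = P.A c' k := by
  unfold A
  refine Finset.sum_congr rfl fun i hi => ?_
  have hi := Finset.mem_range.1 hi
  rw [P.rprod_succ_congr (h.mono hi.le), qprod_congr (h.mono hi.le), h i hi]

theorem r_ge (c : ℕ → ℕ) (k : ℕ) : (1 : ℝ) ≤ P.r c k := by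
  exact_mod_cast P.φ_pos _

variable {P}

theorem Admissible.ge {c : ℕ → ℕ} (h : P.Admissible c) (k : ℕ) : (P.r c k : ℝ) + 1 ≤ c k := by
  exact_mod_cast h k

theorem qprod_pos {c : ℕ → ℕ} (h : P.Admissible c) (k : ℕ) : 0 < qprod c k := by
  unfold qprod
  refine Finset.prod_pos fun i _ => ?_
  have h1 := h.ge i
  have h2 := P.r_ge c i
  exact mul_pos (by linarith) (by linarith)

theorem rprod_pos (c : ℕ → ℕ) (k : ℕ) : 0 < P.rprod c k := by
  unfold rprod
  refine Finset.prod_pos fun i _ => ?_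
  have h2 := P.r_ge c i
  linarith

theorem D_pos {c : ℕ → ℕ} (h : P.Admissible c) (k : ℕ) : 0 < P.D c k :=
  div_pos (rprod_pos c k) (qprod_pos h k)

theorem rprod_succ (c : ℕ → ℕ) (k : ℕ) : P.rprod c (k + 1) = P.rprod c k * P.r c k := by
  simp [rprod, Finset.prod_range_succ]

theorem D_succ {c : ℕ → ℕ} (h : P.Admissible c) (k : ℕ) :
    P.D c (k + 1) = P.D c k * P.r c k / ((c k : ℝ) - 1) - P.D c k * P.r c k / c k := by
  have h1 := h.ge k
  have h2 := P.r_ge c k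
  have h3 := qprod_pos h k
  have h4 : (c k : ℝ) ≠ 0 := by intro h; linarith
  have h5 : (c k : ℝ) - 1 ≠ 0 := by intro h; linarith
  have hq : qprod c (k + 1) = qprod c k * (((c k : ℝ) - 1) * c k) := by
    simp [qprod, Finset.prod_range_succ]
  unfold D
  rw [rprod_succ, hq]
  field_simp
  ring

theorem S_succ {c : ℕ → ℕ} (h : P.Admissible c) (k : ℕ) :
    P.S c (k + 1) = P.S c k + P.D c k * P.r c k / c k := by
  have h3 := (qprod_pos h k).ne'
  unfold S D
  rw [Finset.sum_range_succ, rprod_succ]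
  congr 1
  rw [div_mul_eq_mul_div, div_div]

theorem A_succ {c : ℕ → ℕ} (h : P.Admissible c) (k : ℕ) :
    P.A c (k + 1) = P.A c k + (-1 : ℝ) ^ k * (P.D c k * P.r c k / ((c k : ℝ) - 1)) := by
  unfold A D
  rw [Finset.sum_range_succ, rprod_succ]
  congr 1
  rw [div_mul_eq_mul_div, div_div, mul_div_assoc]

/-- Elementary bounds for the endpoints of the subcylinder. -/
theorem sub_bounds {c : ℕ → ℕ} (h : P.Admissible c) (k : ℕ) :
    0 ≤ P.D c k * P.r c k / c k ∧ P.D c k * P.r c k / ((c k : ℝ) - 1) ≤ P.D c k := by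
  have h1 := h.ge k
  have h2 := P.r_ge c k
  have h3 := D_pos h k
  constructor
  · apply div_nonneg <;> nlinarith
  · rw [div_le_iff₀ (by linarith)]
    nlinarith

theorem D_succ_le {c : ℕ → ℕ} (h : P.Admissible c) (k : ℕ) :
    P.D c (k + 1) ≤ P.D c k / 2 := by
  have h1 := h.ge k
  have h2 := P.r_ge c k
  have h3 := D_pos h k
  rw [D_succ h, div_sub_div _ _ (by linarith) (by linarith),
    div_le_div_iff₀ (mul_pos (by linarith) (by linarith)) (by norm_num)]
  have : (P.r c k : ℝ) * 2 ≤ (c k - 1) * c k := by nlinarith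
  nlinarith

theorem D_le_pow {c : ℕ → ℕ} (h : P.Admissible c) (k : ℕ) : P.D c k ≤ (1 / 2 : ℝ) ^ k := by
  induction k with
  | zero => simp [D, rprod, qprod]
  | succ k ih =>
    have := D_succ_le h k
    rw [pow_succ]
    linarith

theorem S_tendsto {c : ℕ → ℕ} (h : P.Admissible c) :
    Tendsto (P.S c) atTop (nhds (P.posValue c)) := by
  have hs : Summable fun n : ℕ => P.rprod c (n + 1) / (qprod c n * (c n : ℝ)) := by
    refine Summable.of_nonneg_of_le (fun n => ?_) (fun n => ?_)
      (summable_geometric_of_lt_one (r := (1 / 2 : ℝ)) (by norm_num) (by norm_num))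
    · exact div_nonneg (rprod_pos _ _).le (mul_nonneg (qprod_pos h n).le (by positivity))
    · have e : P.rprod c (n + 1) / (qprod c n * (c n : ℝ)) = P.D c n * P.r c n / c n := by
        rw [rprod_succ, D, div_mul_eq_mul_div, div_div]
      rw [e]
      have h1 := D_succ h n
      have h2 := sub_bounds h n
      have h3 := D_pos h (n + 1)
      have h4 := D_le_pow h n
      linarith
  exact hs.hasSum.tendsto_sum_nat

theorem A_tendsto {c : ℕ → ℕ} (h : P.Admissible c) :
    Tendsto (P.A c) atTop (nhds (P.altValue c)) := by
  have hs : Summable fun n : ℕ =>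
      (-1 : ℝ) ^ n * P.rprod c (n + 1) / (qprod c n * ((c n : ℝ) - 1)) := by
    refine Summable.of_norm_bounded
      (summable_geometric_of_lt_one (r := (1 / 2 : ℝ)) (by norm_num) (by norm_num)) (fun n => ?_)
    have e : (-1 : ℝ) ^ n * P.rprod c (n + 1) / (qprod c n * ((c n : ℝ) - 1))
        = (-1 : ℝ) ^ n * (P.D c n * P.r c n / ((c n : ℝ) - 1)) := by
      rw [rprod_succ, D, div_mul_eq_mul_div, div_div, mul_div_assoc]
    have h1 := D_succ h n
    have h2 := sub_bounds h n
    have h3 := D_pos h (n + 1)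
    have h4 := D_le_pow h n
    rw [e, norm_mul, norm_pow, norm_neg, norm_one, one_pow, one_mul, Real.norm_eq_abs,
      abs_of_nonneg (by linarith)]
    linarith
  exact hs.hasSum.tendsto_sum_nat

theorem S_bounds {c : ℕ → ℕ} (h : P.Admissible c) (m : ℕ) : ∀ k,
    0 ≤ P.S c (k + m) - P.S c k ∧ P.S c (k + m) - P.S c k ≤ P.D c k := by
  induction m with
  | zero => intro k; simpa using (D_pos h k).le
  | succ m ih =>
    intro k
    have h0 := ih (k + 1)
    have h1 := D_succ h k
    have h2 := sub_bounds h k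
    have h3 := S_succ h k
    rw [show k + (m + 1) = k + 1 + m by ring]
    constructor <;> linarith

theorem A_bounds {c : ℕ → ℕ} (h : P.Admissible c) (m : ℕ) : ∀ k,
    0 ≤ (-1 : ℝ) ^ k * (P.A c (k + m) - P.A c k) ∧
      (-1 : ℝ) ^ k * (P.A c (k + m) - P.A c k) ≤ P.D c k := by
  induction m with
  | zero => intro k; simpa using (D_pos h k).le
  | succ m ih =>
    intro k
    have h0 := ih (k + 1)
    have h1 := D_succ h k
    have h2 := sub_bounds h k
    have h3 := A_succ h k
    rw [show k + (m + 1) = k + 1 + m by ring]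
    rw [pow_succ] at h0
    have hsq : (-1 : ℝ) ^ k * (-1 : ℝ) ^ k = 1 := by rw [← mul_pow]; simp
    have e : (-1 : ℝ) ^ k * (P.A c (k + 1 + m) - P.A c k) =
        (-1 : ℝ) ^ k * (P.A c (k + 1 + m) - P.A c (k + 1)) +
          P.D c k * P.r c k / ((c k : ℝ) - 1) := by
      rw [h3]; linear_combination (P.D c k * P.r c k / ((c k : ℝ) - 1)) * hsq
    rw [e]
    constructor <;> linarith

theorem pos_mem {c : ℕ → ℕ} (h : P.Admissible c) (k : ℕ) :
    0 ≤ P.posValue c - P.S c k ∧ P.posValue c - P.S c k ≤ P.D c k := by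
  have ht : Tendsto (fun m => P.S c (k + m) - P.S c k) atTop (nhds (P.posValue c - P.S c k)) := by
    have := (S_tendsto h).comp (tendsto_add_atTop_nat k)
    refine Tendsto.sub_const ?_ _
    simpa [Function.comp_def, add_comm] using this
  exact ⟨ge_of_tendsto' ht fun m => (S_bounds h m k).1, le_of_tendsto' ht fun m => (S_bounds h m k).2⟩

theorem alt_mem {c : ℕ → ℕ} (h : P.Admissible c) (k : ℕ) :
    0 ≤ (-1 : ℝ) ^ k * (P.altValue c - P.A c k) ∧
      (-1 : ℝ) ^ k * (P.altValue c - P.A c k) ≤ P.D c k := by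
  have ht : Tendsto (fun m => (-1 : ℝ) ^ k * (P.A c (k + m) - P.A c k)) atTop
      (nhds ((-1 : ℝ) ^ k * (P.altValue c - P.A c k))) := by
    have := (A_tendsto h).comp (tendsto_add_atTop_nat k)
    refine Tendsto.const_mul _ (Tendsto.sub_const ?_ _)
    simpa [Function.comp_def, add_comm] using this
  exact ⟨ge_of_tendsto' ht fun m => (A_bounds h m k).1, le_of_tendsto' ht fun m => (A_bounds h m k).2⟩

variable (P) in
/-- Common properties of the positive and the alternating expansions. -/
structure IsCoding (V : (ℕ → ℕ) → ℝ) (B : (ℕ → ℕ) → ℕ → ℝ) (s : ℕ → ℝ) : Prop where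
  sgn : ∀ k, s k = 1 ∨ s k = -1
  congr : ∀ {k c c'}, Agree c c' k → B c k = B c' k
  lo : ∀ {c}, P.Admissible c → ∀ k, P.D c k * P.r c k / c k ≤ s k * (V c - B c k)
  hi : ∀ {c}, P.Admissible c → ∀ k, s k * (V c - B c k) ≤ P.D c k * P.r c k / ((c k : ℝ) - 1)

theorem posCoding : P.IsCoding P.posValue P.S (fun _ => 1) where
  sgn _ := Or.inl rfl
  congr h := P.S_congr h
  lo h k := by
    have := pos_mem h (k + 1)
    have h3 := S_succ h k
    linarith
  hi h k := by
    have := pos_mem h (k + 1)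
    have h3 := S_succ h k
    have h1 := D_succ h k
    linarith

theorem alt_step {c : ℕ → ℕ} (h : P.Admissible c) (k : ℕ) :
    (-1 : ℝ) ^ k * (P.altValue c - P.A c k) = P.D c k * P.r c k / ((c k : ℝ) - 1) -
      (-1 : ℝ) ^ (k + 1) * (P.altValue c - P.A c (k + 1)) := by
  have hsq : (-1 : ℝ) ^ k * (-1 : ℝ) ^ k = 1 := by rw [← mul_pow]; simp
  rw [A_succ h k, pow_succ]
  linear_combination (P.D c k * P.r c k / ((c k : ℝ) - 1)) * hsq

theorem altCoding : P.IsCoding P.altValue P.A (fun k => (-1) ^ k) where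
  sgn k := neg_one_pow_eq_or ℝ k
  congr h := P.A_congr h
  lo h k := by
    have := alt_mem h (k + 1)
    have h3 := alt_step h k
    have h1 := D_succ h k
    linarith
  hi h k := by
    have := alt_mem h (k + 1)
    have h3 := alt_step h k
    linarith

section general

variable {V V' : (ℕ → ℕ) → ℝ} {B B' : (ℕ → ℕ) → ℕ → ℝ} {s s' : ℕ → ℝ}

theorem IsCoding.abs_bound (hV : P.IsCoding V B s) {x y : ℕ → ℕ} {k : ℕ} {lo hi ε : ℝ}
    (hxy : Agree x y k)
    (hx : lo ≤ s k * (V x - B x k)) (hx' : s k * (V x - B x k) ≤ hi)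
    (hy : lo ≤ s k * (V y - B y k)) (hy' : s k * (V y - B y k) ≤ hi) (hε : hi - lo ≤ ε) :
    |V x - V y| ≤ ε := by
  rw [hV.congr hxy] at hx hx'
  rw [abs_le]
  rcases hV.sgn k with h | h <;> rw [h] at hx hx' hy hy' <;> constructor <;> linarith

theorem IsCoding.base (hV : P.IsCoding V B s) (hV' : P.IsCoding V' B' s') {x y : ℕ → ℕ} {k : ℕ}
    {δ : ℝ} (hx : P.Admissible x) (hy : P.Admissible y) (hxy : Agree x y k)
    (h1 : s k * (V x - B x k) ≤ δ) (h2 : s k * (V y - B y k) ≤ δ) : |V' x - V' y| ≤ 2 * δ := by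
  have key : ∀ z, P.Admissible z → s k * (V z - B z k) ≤ δ →
      0 ≤ s' k * (V' z - B' z k) ∧ s' k * (V' z - B' z k) ≤ 2 * δ := by
    intro z hz h
    have a1 := hV.lo hz k
    have a2 := hV'.hi hz k
    have a3 := hV'.lo hz k
    have a4 := sub_bounds hz k
    have b1 := hz.ge k
    have b2 := P.r_ge z k
    have b3 := D_pos hz k
    have : P.D z k * P.r z k / ((z k : ℝ) - 1) ≤ 2 * (P.D z k * P.r z k / z k) := by
      rw [← mul_div_assoc, div_le_div_iff₀ (by linarith) (by linarith)]
      have : 0 ≤ P.D z k * P.r z k := by positivity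
      nlinarith
    constructor <;> linarith
  obtain ⟨x1, x2⟩ := key x hx h1
  obtain ⟨y1, y2⟩ := key y hy h2
  exact hV'.abs_bound hxy x1 x2 y1 y2 (by linarith)

theorem IsCoding.far_aux (hV : P.IsCoding V B s) (hV' : P.IsCoding V' B' s') {x z : ℕ → ℕ} {k : ℕ}
    {δ : ℝ} (hx : P.Admissible x) (hz : P.Admissible z) (hxz : Agree x z k)
    (hle : x k ≤ z k) (hr : P.r z k + 2 ≤ z k)
    (h2 : P.D z k - s k * (V z - B z k) ≤ δ) : P.D x k - s' k * (V' x - B' x k) ≤ 2 * δ := by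
  have a1 := hV.hi hz k
  have a2 := hV'.lo hx k
  rw [P.D_congr hxz, P.r_congr hxz] at *
  have b1 := hx.ge k
  rw [P.r_congr hxz] at b1
  have b2 := P.r_ge z k
  have b3 := D_pos hz k
  have hle' : (x k : ℝ) ≤ z k := by exact_mod_cast hle
  have hr' : (P.r z k : ℝ) + 2 ≤ z k := by exact_mod_cast hr
  have c1 : P.D z k * P.r z k / z k ≤ P.D z k * P.r z k / x k :=
    div_le_div_of_nonneg_left (by positivity) (by linarith) hle'
  have c2 : P.D z k - P.D z k * P.r z k / z k ≤
      2 * (P.D z k - P.D z k * P.r z k / ((z k : ℝ) - 1)) := by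
    have e1 : P.D z k - P.D z k * P.r z k / z k = P.D z k * ((z k - P.r z k) / z k) := by
      have : (z k : ℝ) ≠ 0 := by intro h; linarith
      field_simp
    have e2 : 2 * (P.D z k - P.D z k * P.r z k / ((z k : ℝ) - 1)) =
        P.D z k * (2 * (z k - 1 - P.r z k) / (z k - 1)) := by
      have : (z k : ℝ) - 1 ≠ 0 := by intro h; linarith
      field_simp
    rw [e1, e2]
    apply mul_le_mul_of_nonneg_left _ b3.le
    rw [div_le_div_iff₀ (by linarith) (by linarith)]
    nlinarith
  linarith

/-- Far end, when some element `w` has a non-minimal digit. -/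
theorem IsCoding.far (hV : P.IsCoding V B s) (hV' : P.IsCoding V' B' s') {x y w : ℕ → ℕ} {k : ℕ}
    {δ : ℝ} (hx : P.Admissible x) (hy : P.Admissible y) (hw : P.Admissible w)
    (hxw : Agree x w k) (hyw : Agree y w k) (hr : P.r w k + 2 ≤ w k)
    (h1 : P.D x k - s k * (V x - B x k) ≤ δ) (h2 : P.D y k - s k * (V y - B y k) ≤ δ)
    (h3 : P.D w k - s k * (V w - B w k) ≤ δ) : |V' x - V' y| ≤ 2 * δ := by
  have key : ∀ z, P.Admissible z → Agree z w k → P.D z k - s k * (V z - B z k) ≤ δ →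
      P.D w k - 2 * δ ≤ s' k * (V' z - B' z k) ∧ s' k * (V' z - B' z k) ≤ P.D w k := by
    intro z hz hzw h
    have a2 := hV'.hi hz k
    have a4 := sub_bounds hz k
    have : P.D z k - s' k * (V' z - B' z k) ≤ 2 * δ := by
      rcases le_total (z k) (w k) with hle | hle
      · exact hV.far_aux hV' hz hw hzw hle hr h3
      · refine hV.far_aux hV' hz hz (fun _ _ => rfl) le_rfl ?_ h
        rw [P.r_congr hzw]
        omega
    rw [P.D_congr hzw] at *
    constructor <;> linarith
  obtain ⟨x1, x2⟩ := key x hx hxw h1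
  obtain ⟨y1, y2⟩ := key y hy hyw h2
  exact hV'.abs_bound (fun i hi => (hxw i hi).trans (hyw i hi).symm) x1 x2 y1 y2 (by linarith)

/-- The covering lemma, given a treatment of the two end pieces. -/
theorem IsCoding.cover (hV : P.IsCoding V B s) (hV' : P.IsCoding V' B' s')
    (hend : ∀ (T : Set (ℕ → ℕ)) (k : ℕ) (δ : ℝ), (∀ x ∈ T, P.Admissible x) →
      (∀ x ∈ T, ∀ y ∈ T, Agree x y (k + 1)) →
      ((∀ x ∈ T, s k * (V x - B x k) - P.D x k * P.r x k / x k ≤ δ) ∨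
        (∀ x ∈ T, P.D x k * P.r x k / ((x k : ℝ) - 1) - s k * (V x - B x k) ≤ δ)) →
      ∀ x ∈ T, ∀ y ∈ T, |V' x - V' y| ≤ 2 * δ)
    (T : Set (ℕ → ℕ)) (hT : ∀ x ∈ T, P.Admissible x) (δ : ℝ) (hδ : 0 ≤ δ)
    (hd : ∀ x ∈ T, ∀ y ∈ T, |V x - V y| ≤ δ) :
    ∃ U : Fin 3 → Set (ℕ → ℕ), T ⊆ ⋃ j, U j ∧ (∀ j, U j ⊆ T) ∧
        ∀ j, ∀ x ∈ U j, ∀ y ∈ U j, |V' x - V' y| ≤ 2 * δ := by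
  classical
  by_cases hsub : T.Subsingleton
  · refine ⟨fun _ => T, fun x hx => mem_iUnion.2 ⟨0, hx⟩, fun _ => le_rfl, ?_⟩
    intro j x hx y hy
    rw [hsub hx hy]
    simpa using hδ
  have hex : ∃ k, ∃ x ∈ T, ∃ y ∈ T, x k ≠ y k := by
    by_contra hcon
    push Not at hcon
    exact hsub fun x hx y hy => funext fun k => hcon k x hx y hy
  let k := Nat.find hex
  have hag : ∀ x ∈ T, ∀ y ∈ T, Agree x y k := by
    intro x hx y hy i hi
    by_contra hne
    exact Nat.find_min hex hi ⟨x, hx, y, hy, hne⟩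
  obtain ⟨p, hp, q, hq, hpq⟩ : ∃ x ∈ T, ∃ y ∈ T, x k ≠ y k := Nat.find_spec hex
  clear_value k
  have hexn : ∃ n, ∃ x ∈ T, x k = n := ⟨_, p, hp, rfl⟩
  obtain ⟨a, ha, han⟩ := Nat.find_spec hexn
  have hmin : ∀ x ∈ T, a k ≤ x k := by
    intro x hx
    rw [han]
    exact Nat.find_min' hexn ⟨x, hx, rfl⟩
  clear han
  obtain ⟨b, hb, hab⟩ : ∃ b ∈ T, a k < b k := by
    rcases lt_or_gt_of_ne hpq with h | h
    · exact ⟨q, hq, (hmin p hp).trans_lt h⟩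
    · exact ⟨p, hp, (hmin q hq).trans_lt h⟩
  -- everything relative to `a`
  let C : ℝ := P.D a k * P.r a k
  have hC : 0 ≤ C := mul_nonneg (D_pos (hT a ha) k).le (by positivity)
  have hDr : ∀ x ∈ T, P.D x k * P.r x k = C := by
    intro x hx
    rw [P.D_congr (hag x hx a ha), P.r_congr (hag x hx a ha)]
  have hlo : ∀ x ∈ T, C / x k ≤ s k * (V x - B x k) := by
    intro x hx
    rw [← hDr x hx]; exact hV.lo (hT x hx) k
  have hhi : ∀ x ∈ T, s k * (V x - B x k) ≤ C / ((x k : ℝ) - 1) := by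
    intro x hx
    rw [← hDr x hx]; exact hV.hi (hT x hx) k
  have hlo' : ∀ x ∈ T, C / x k ≤ s' k * (V' x - B' x k) := by
    intro x hx
    rw [← hDr x hx]; exact hV'.lo (hT x hx) k
  have hhi' : ∀ x ∈ T, s' k * (V' x - B' x k) ≤ C / ((x k : ℝ) - 1) := by
    intro x hx
    rw [← hDr x hx]; exact hV'.hi (hT x hx) k
  have hge : ∀ x ∈ T, (2 : ℝ) ≤ x k := by
    intro x hx
    have h1 := (hT x hx).ge k
    have h2 := P.r_ge x k
    linarith
  have hdu : ∀ x ∈ T, ∀ y ∈ T, s k * (V x - B x k) - s k * (V y - B y k) ≤ δ := by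
    intro x hx y hy
    have h1 := abs_le.1 (hd x hx y hy)
    rw [hV.congr (hag x hx y hy)]
    rcases hV.sgn k with h | h <;> rw [h] <;> linarith
  have hstep : ∀ x ∈ T, ∀ y ∈ T, x k < y k → C / ((y k : ℝ) - 1) ≤ C / x k := by
    intro x hx y hy hlt
    have : (x k : ℝ) + 1 ≤ y k := by exact_mod_cast hlt
    exact div_le_div_of_nonneg_left hC (by linarith [hge x hx]) (by linarith)
  let U0 : Set (ℕ → ℕ) := {x | x ∈ T ∧ x k = a k}
  let U1 : Set (ℕ → ℕ) := {x | x ∈ T ∧ a k < x k ∧ ∃ y ∈ T, x k < y k}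
  let U2 : Set (ℕ → ℕ) := {x | x ∈ T ∧ a k < x k ∧ ∀ y ∈ T, y k ≤ x k}
  have g0 : ∀ x ∈ U0, ∀ y ∈ U0, |V' x - V' y| ≤ 2 * δ := by
    refine hend U0 k δ (fun x hx => hT x hx.1)
      (fun x hx y hy => (hag x hx.1 y hy.1).succ (hx.2.trans hy.2.symm)) (Or.inl ?_)
    intro x hx
    rw [hDr x hx.1, hx.2]
    have h1 := hdu x hx.1 b hb
    have h2 := hstep a ha b hb hab
    have h3 := hhi b hb
    linarith
  have g2 : ∀ x ∈ U2, ∀ y ∈ U2, |V' x - V' y| ≤ 2 * δ := by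
    refine hend U2 k δ (fun x hx => hT x hx.1)
      (fun x hx y hy => (hag x hx.1 y hy.1).succ
        (le_antisymm (hy.2.2 x hx.1) (hx.2.2 y hy.1))) (Or.inr ?_)
    intro x hx
    rw [hDr x hx.1]
    have h1 := hdu a ha x hx.1
    have h2 := hstep a ha x hx.1 hx.2.1
    have h3 := hlo a ha
    linarith
  have g1 : ∀ x ∈ U1, ∀ y ∈ U1, |V' x - V' y| ≤ 2 * δ := by
    have hm : ∀ x ∈ U1, ∀ y ∈ U1, x k ≤ y k → |V' x - V' y| ≤ 2 * δ := by
      intro x hx y hy hle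
      obtain ⟨z, hz, hyz⟩ := hy.2.2
      have h1 := hdu a ha z hz
      have h2 := hstep a ha x hx.1 hx.2.1
      have h3 := hstep y hy.1 z hz hyz
      have h4 := hlo a ha
      have h5 := hhi z hz
      have hle' : (x k : ℝ) ≤ y k := by exact_mod_cast hle
      have h6 : C / y k ≤ C / x k :=
        div_le_div_of_nonneg_left hC (by linarith [hge x hx.1]) hle'
      have h7 : C / ((y k : ℝ) - 1) ≤ C / ((x k : ℝ) - 1) :=
        div_le_div_of_nonneg_left hC (by linarith [hge x hx.1]) (by linarith)
      exact hV'.abs_bound (hag x hx.1 y hy.1) (h6.trans (hlo' x hx.1)) (hhi' x hx.1)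
        (hlo' y hy.1) ((hhi' y hy.1).trans h7) (by linarith)
    intro x hx y hy
    rcases le_total (x k) (y k) with h | h
    · exact hm x hx y hy h
    · rw [abs_sub_comm]; exact hm y hy x hx h
  refine ⟨![U0, U1, U2], ?_, ?_, ?_⟩
  · intro x hx
    rw [mem_iUnion]
    rcases (hmin x hx).eq_or_lt with h | h
    · exact ⟨0, hx, h.symm⟩
    · by_cases hc : ∃ y ∈ T, x k < y k
      · exact ⟨1, hx, h, hc⟩
      · push Not at hc
        exact ⟨2, hx, h, hc⟩
  · intro j
    fin_cases j
    · exact fun x hx => hx.1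
    · exact fun x hx => hx.1
    · exact fun x hx => hx.1
  · intro j
    fin_cases j
    · exact g0
    · exact g1
    · exact g2

end general

theorem digit_min {x : ℕ → ℕ} (h : P.Admissible x) {k : ℕ} (hk : ¬ P.r x k + 2 ≤ x k) :
    x k = P.r x k + 1 := by
  have := h k
  omega

/-- The far end of the minimal subcylinder. -/
theorem sub_min {x : ℕ → ℕ} {k : ℕ} (hk : x k = P.r x k + 1) :
    P.D x k * P.r x k / ((x k : ℝ) - 1) = P.D x k := by
  have h2 := P.r_ge x k
  rw [hk]
  push_cast
  rw [add_sub_cancel_right, mul_div_assoc, div_self (by linarith), mul_one]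

theorem pos_far {V' : (ℕ → ℕ) → ℝ} {B' : (ℕ → ℕ) → ℕ → ℝ} {s' : ℕ → ℝ}
    (hV' : P.IsCoding V' B' s')
    (T : Set (ℕ → ℕ)) (k : ℕ) (δ : ℝ) (hδ : 0 ≤ δ) (hT : ∀ x ∈ T, P.Admissible x)
    (hag : ∀ x ∈ T, ∀ y ∈ T, Agree x y k)
    (hfar : ∀ x ∈ T, P.D x k - (P.posValue x - P.S x k) ≤ δ) :
    ∀ x ∈ T, ∀ y ∈ T, |V' x - V' y| ≤ 2 * δ := by
  classical
  by_cases hex : ∃ m, ∃ w ∈ T, P.r w (k + m) + 2 ≤ w (k + m)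
  · have hmin : ∀ m, m ≤ Nat.find hex → (∀ x ∈ T, ∀ y ∈ T, Agree x y (k + m)) ∧
        (∀ x ∈ T, P.D x (k + m) - (P.posValue x - P.S x (k + m)) ≤ δ) := by
      intro m
      induction m with
      | zero => intro _; exact ⟨hag, hfar⟩
      | succ m ih =>
        intro hm
        obtain ⟨i1, i2⟩ := ih (by omega)
        have hd : ∀ x ∈ T, x (k + m) = P.r x (k + m) + 1 := by
          intro x hx
          refine digit_min (hT x hx) fun hcon => ?_
          exact Nat.find_min hex (m := m) (by omega) ⟨x, hx, hcon⟩
        refine ⟨fun x hx y hy => (i1 x hx y hy).succ ?_, fun x hx => ?_⟩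
        · rw [hd x hx, hd y hy, P.r_congr (i1 x hx y hy)]
        · have h1 := i2 x hx
          have h2 := sub_min (hd x hx)
          have h3 := S_succ (hT x hx) (k + m)
          have h4 := D_succ (hT x hx) (k + m)
          rw [← add_assoc]
          linarith
    obtain ⟨i1, i2⟩ := hmin _ le_rfl
    obtain ⟨w, hw, hwr⟩ := Nat.find_spec hex
    intro x hx y hy
    refine posCoding.far hV' (hT x hx) (hT y hy) (hT w hw) (i1 x hx w hw) (i1 y hy w hw) hwr ?_ ?_ ?_
    · simpa using i2 x hx
    · simpa using i2 y hy
    · simpa using i2 w hw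
  · push Not at hex
    have hd : ∀ x ∈ T, ∀ m, x (k + m) = P.r x (k + m) + 1 := by
      intro x hx m
      exact digit_min (hT x hx) (by have := hex m x hx; omega)
    intro x hx y hy
    have hall : ∀ m, Agree x y (k + m) := by
      intro m
      induction m with
      | zero => exact hag x hx y hy
      | succ m ih =>
        exact ih.succ (by rw [hd x hx, hd y hy, P.r_congr ih])
    have : x = y := funext fun i => hall (i + 1) i (by omega)
    rw [this]
    simpa using hδ

theorem pos_to_alt (T : Set (ℕ → ℕ)) (hT : ∀ x ∈ T, P.Admissible x) (δ : ℝ) (hδ : 0 ≤ δ)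
    (hd : ∀ x ∈ T, ∀ y ∈ T, |P.posValue x - P.posValue y| ≤ δ) :
    ∃ U : Fin 3 → Set (ℕ → ℕ), T ⊆ ⋃ j, U j ∧ (∀ j, U j ⊆ T) ∧
        ∀ j, ∀ x ∈ U j, ∀ y ∈ U j, |P.altValue x - P.altValue y| ≤ 2 * δ := by
  refine posCoding.cover altCoding ?_ T hT δ hδ hd
  intro T k δ hT hag h x hx y hy
  rcases h with h | h
  · have key : ∀ z ∈ T, 1 * (P.posValue z - P.S z (k + 1)) ≤ δ := by
      intro z hz
      have h1 := h z hz
      have h3 := S_succ (hT z hz) k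
      linarith
    exact posCoding.base altCoding (hT x hx) (hT y hy) (hag x hx y hy) (key x hx) (key y hy)
  · have hδ : 0 ≤ δ := le_trans (sub_nonneg.2 (posCoding.hi (hT x hx) k)) (h x hx)
    refine pos_far altCoding T (k + 1) δ hδ hT hag ?_ x hx y hy
    intro z hz
    have h1 := h z hz
    have h3 := S_succ (hT z hz) k
    have h4 := D_succ (hT z hz) k
    linarith

theorem alt_to_pos (T : Set (ℕ → ℕ)) (hT : ∀ x ∈ T, P.Admissible x) (δ : ℝ) (hδ : 0 ≤ δ)
    (hd : ∀ x ∈ T, ∀ y ∈ T, |P.altValue x - P.altValue y| ≤ δ) :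
    ∃ U : Fin 3 → Set (ℕ → ℕ), T ⊆ ⋃ j, U j ∧ (∀ j, U j ⊆ T) ∧
        ∀ j, ∀ x ∈ U j, ∀ y ∈ U j, |P.posValue x - P.posValue y| ≤ 2 * δ := by
  refine altCoding.cover posCoding ?_ T hT δ hδ hd
  intro T k δ hT hag h x hx y hy
  rcases h with h | h
  · have key : ∀ z ∈ T, P.D z (k + 1) - (-1) ^ (k + 1) * (P.altValue z - P.A z (k + 1)) ≤ δ := by
      intro z hz
      have h1 := h z hz
      have h3 := alt_step (hT z hz) k
      have h4 := D_succ (hT z hz) k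
      linarith
    by_cases hex : ∃ w ∈ T, P.r w (k + 1) + 2 ≤ w (k + 1)
    · obtain ⟨w, hw, hwr⟩ := hex
      exact altCoding.far posCoding (hT x hx) (hT y hy) (hT w hw) (hag x hx w hw) (hag y hy w hw)
        hwr (key x hx) (key y hy) (key w hw)
    · push Not at hex
      have hm : ∀ z ∈ T, z (k + 1) = P.r z (k + 1) + 1 := fun z hz =>
        digit_min (hT z hz) (by have := hex z hz; omega)
      have key2 : ∀ z ∈ T, (-1) ^ (k + 1 + 1) * (P.altValue z - P.A z (k + 1 + 1)) ≤ δ := by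
        intro z hz
        have h1 := key z hz
        have h3 := alt_step (hT z hz) (k + 1)
        have h4 := sub_min (hm z hz)
        linarith
      refine altCoding.base posCoding (hT x hx) (hT y hy) ((hag x hx y hy).succ ?_)
        (key2 x hx) (key2 y hy)
      rw [hm x hx, hm y hy, P.r_congr (hag x hx y hy)]
  · have key : ∀ z ∈ T, (-1) ^ (k + 1) * (P.altValue z - P.A z (k + 1)) ≤ δ := by
      intro z hz
      have h1 := h z hz
      have h3 := alt_step (hT z hz) k
      linarith
    exact altCoding.base posCoding (hT x hx) (hT y hy) (hag x hx y hy) (key x hx) (key y hy)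

end PerronSystem

/-- Fractal equivalence principle for the Perron expansions: for every set `𝔐`
of digit sequences, the set of positive Perron values with digits in `𝔐` and the set of
alternating Perron values with digits in `𝔐` have the same Hausdorff dimension. -/
theorem fractal_equivalence_principle (P : PerronSystem) (𝔐 : Set (ℕ → ℕ)) :
    dimH {x : ℝ | ∃ c : ℕ → ℕ, P.Admissible c ∧ c ∈ 𝔐 ∧ x = P.posValue c} =
      dimH {x : ℝ | ∃ c : ℕ → ℕ, P.Admissible c ∧ c ∈ 𝔐 ∧ x = P.altValue c} := by
  have e1 : {x : ℝ | ∃ c : ℕ → ℕ, P.Admissible c ∧ c ∈ 𝔐 ∧ x = P.posValue c} =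
      P.posValue '' {c | P.Admissible c ∧ c ∈ 𝔐} := by
    ext x
    constructor
    · rintro ⟨c, h1, h2, rfl⟩
      exact ⟨c, ⟨h1, h2⟩, rfl⟩
    · rintro ⟨c, ⟨h1, h2⟩, rfl⟩
      exact ⟨c, h1, h2, rfl⟩
  have e2 : {x : ℝ | ∃ c : ℕ → ℕ, P.Admissible c ∧ c ∈ 𝔐 ∧ x = P.altValue c} =
      P.altValue '' {c | P.Admissible c ∧ c ∈ 𝔐} := by
    ext x
    constructor
    · rintro ⟨c, h1, h2, rfl⟩
      exact ⟨c, ⟨h1, h2⟩, rfl⟩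
    · rintro ⟨c, ⟨h1, h2⟩, rfl⟩
      exact ⟨c, h1, h2, rfl⟩
  rw [e1, e2]
  apply le_antisymm
  · exact dimH_transfer _ _ _ fun T hT δ hδ hd =>
      PerronSystem.alt_to_pos T (fun x hx => (hT hx).1) δ hδ hd
  · exact dimH_transfer _ _ _ fun T hT δ hδ hd =>
      PerronSystem.pos_to_alt T (fun x hx => (hT hx).1) δ hδ hd
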